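/- Let 1 < p < ∞, δ ≥ 1, ε > δ, and q > q*(p,ε). Let s⁺ ∈ [0,1/p] be the unique solution of (1 − p s)^{p−1}/(1 − (p−1) s)^p = ε^{−p} and γ = p + q' − 1. Then for every bounded interval J ⊂ ℝ and every weight w ∈ RH_p^δ(J), writing x₁ = ⟨w⟩_J, x₂ = ⟨w^p⟩_J, and letting r⁺ ∈ [0,1/p] be the unique solution of (1 − p r)^{p−1}/(1 − (p−1) r)^p = x₂/(ε x₁)^p, one has ⟨w^{1−q'}⟩_J ≤ x₁^{1−q'} · ((1 − p s⁺)/(1 − p r⁺))^{q'} · ((1 − (p−1) r⁺)/(1 − (p−1) s⁺))^{q'−1} · (1 − γ r⁺)/(1 − γ s⁺). -/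

import Mathlib

open MeasureTheory Set ENNReal

/-- The average `⟨f⟩_{(a,b)}` of an `ℝ≥0∞`-valued function over an interval. -/
noncomputable def avgE (f : ℝ → ℝ≥0∞) (a b : ℝ) : ℝ≥0∞ :=
  (∫⁻ t in Set.Ioo a b, f t) / ENNReal.ofReal (b - a)

/-- `w ∈ RH_p^δ([A,B])`. -/
def MemRH (p δ A B : ℝ) (w : ℝ → ℝ≥0∞) : Prop :=
  Measurable w ∧ (∫⁻ t in Set.Ioo A B, w t) ≠ ⊤ ∧
    ∀ a b, A ≤ a → a < b → b ≤ B →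
      avgE (fun t => w t ^ p) a b ≤ ENNReal.ofReal δ ^ p * (avgE w a b) ^ p

open Filter Topology

/-- At a tangency parameter `u`, the supporting functional of the Bellman function. -/
noncomputable def supportFun (p b l W V u : ℝ) : ℝ :=
  (b + 1) * (p + b) / p * l * u ^ (-b) - b * (p + b) / (p - 1) * W * u ^ (-b - 1)
    + b * (b + 1) / (p * (p - 1)) * V * u ^ (-b - p)

theorem hasDerivAt_supportFun {p b l W V u : ℝ} (hp : 1 < p) (hu : 0 < u) :
    HasDerivAt (supportFun p b l W V)
      (b * (b + 1) * (p + b) / (p * (p - 1)) * u ^ (-b - p - 1) *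
        (p * W * u ^ (p - 1) - (p - 1) * l * u ^ p - V)) u := by
  have h (e : ℝ) := Real.hasDerivAt_rpow_const (x := u) (p := e) (Or.inl hu.ne')
  have H := (((h (-b)).const_mul ((b + 1) * (p + b) / p * l)).sub
    ((h (-b - 1)).const_mul (b * (p + b) / (p - 1) * W))).add
    ((h (-b - p)).const_mul (b * (b + 1) / (p * (p - 1)) * V))
  refine H.congr_deriv ?_
  have e1 : u ^ (-b - 1) = u ^ (-b - p - 1) * u ^ p := by
    rw [← Real.rpow_add hu]; ring_nf
  have e2 : u ^ (-b - 1 - 1) = u ^ (-b - p - 1) * u ^ (p - 1) := by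
    rw [← Real.rpow_add hu]; ring_nf
  rw [e1, e2]
  have : p ≠ 0 := by linarith
  have : p - 1 ≠ 0 := by linarith
  field_simp
  ring

theorem monotoneOn_tangent {p y : ℝ} (hp : 1 < p) :
    MonotoneOn (fun u : ℝ => p * y * u ^ (p - 1) - (p - 1) * u ^ p) (Icc 0 y) := by
  have hc : ContinuousOn (fun u : ℝ => p * y * u ^ (p - 1) - (p - 1) * u ^ p) (Icc 0 y) := by
    refine Continuous.continuousOn ?_
    have h1 := Real.continuous_rpow_const (q := p - 1) (by linarith)
    have h2 := Real.continuous_rpow_const (q := p) (by linarith)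
    fun_prop
  refine monotoneOn_of_hasDerivWithinAt_nonneg (convex_Icc 0 y) hc
    (f' := fun u => p * (p - 1) * u ^ (p - 1 - 1) * (y - u)) ?_ ?_
  · intro u hu
    rw [interior_Icc] at hu
    have h (e : ℝ) := Real.hasDerivAt_rpow_const (x := u) (p := e) (Or.inl hu.1.ne')
    refine (((h (p - 1)).const_mul (p * y)).sub
      ((h p).const_mul (p - 1))).hasDerivWithinAt.congr_deriv ?_
    have e1 : u ^ (p - 1) = u ^ (p - 1 - 1) * u := by
      nth_rw 3 [← Real.rpow_one u]
      rw [← Real.rpow_add hu.1]; ring_nf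
    rw [e1]; ring
  · intro u hu
    rw [interior_Icc] at hu
    have : 0 ≤ u ^ (p - 1 - 1) := Real.rpow_nonneg hu.1.le _
    have : 0 ≤ y - u := by linarith [hu.2]
    have : 0 ≤ p - 1 := by linarith
    positivity

theorem supportFun_le {p b y V u v : ℝ} (hp : 1 < p) (hb : 0 < b) (hu : 0 < u) (huy : u ≤ y)
    (hv : 0 < v) (hvy : v ≤ y) (huV : p * y * u ^ (p - 1) - (p - 1) * u ^ p = V) :
    supportFun p b 1 y V u ≤ supportFun p b 1 y V v := by
  have hmono := monotoneOn_tangent (y := y) hp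
  have hcoef (x : ℝ) (hx : 0 < x) : 0 ≤ b * (b + 1) * (p + b) / (p * (p - 1)) * x ^ (-b - p - 1) := by
    have : 0 < p - 1 := by linarith
    positivity
  rcases le_total u v with h | h
  · refine monotoneOn_of_hasDerivWithinAt_nonneg (convex_Icc u v) (f := supportFun p b 1 y V)
      (fun x hx => (hasDerivAt_supportFun hp
        (hu.trans_le hx.1)).continuousAt.continuousWithinAt)
      (fun x hx => (hasDerivAt_supportFun hp ?_).hasDerivWithinAt) ?_ ⟨le_rfl, h⟩ ⟨h, le_rfl⟩ h
    · rw [interior_Icc] at hx; exact hu.trans hx.1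
    · intro x hx
      rw [interior_Icc] at hx
      have := hmono ⟨hu.le, huy⟩ ⟨hu.le.trans hx.1.le, hx.2.le.trans hvy⟩ hx.1.le
      simp only at this
      exact mul_nonneg (hcoef x (hu.trans hx.1)) (by linarith)
  · refine antitoneOn_of_hasDerivWithinAt_nonpos (convex_Icc v u) (f := supportFun p b 1 y V)
      (fun x hx => (hasDerivAt_supportFun hp
        (hv.trans_le hx.1)).continuousAt.continuousWithinAt)
      (fun x hx => (hasDerivAt_supportFun hp ?_).hasDerivWithinAt) ?_ ⟨le_rfl, h⟩ ⟨h, le_rfl⟩ h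
    · rw [interior_Icc] at hx; exact hv.trans hx.1
    · intro x hx
      rw [interior_Icc] at hx
      have := hmono ⟨hv.le.trans hx.1.le, hx.2.le.trans huy⟩ ⟨hu.le, huy⟩ hx.2.le
      simp only at this
      exact mul_nonpos_of_nonneg_of_nonpos (hcoef x (hv.trans hx.1)) (by linarith)

theorem supportFun_tangent {p b y V u : ℝ} (hp : 1 < p) (hu : 0 < u)
    (huV : p * y * u ^ (p - 1) - (p - 1) * u ^ p = V) :
    supportFun p b 1 y V u = u ^ (-b) * ((b + 1) - b * (y / u)) := by
  have e0 : u ^ (-b - 1) = u ^ (-b) / u := by rw [Real.rpow_sub_one hu.ne']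
  have e1 : u ^ (p - 1) = u ^ p / u := by rw [Real.rpow_sub_one hu.ne']
  have e2 : u ^ (-b - p) = u ^ (-b) / u ^ p := by rw [Real.rpow_sub hu]
  have := Real.rpow_pos_of_pos hu p
  have : p ≠ 0 := by linarith
  have : p - 1 ≠ 0 := by linarith
  rw [supportFun, ← huV, e0, e1, e2]
  field_simp
  ring

theorem exists_tangent {p ρ : ℝ} (hp : 1 < p) (hρ : 0 < ρ) (hρ1 : ρ < 1) :
    ∃ κ : ℝ, 0 < κ ∧ κ < 1 ∧ ∀ y V : ℝ, 0 < y → 0 < V → V ≤ ρ * y ^ p →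
      ∃ u, 0 < u ∧ u ≤ κ * y ∧ p * y * u ^ (p - 1) - (p - 1) * u ^ p = V := by
  have h1 := Real.continuous_rpow_const (q := p - 1) (by linarith)
  have h2 := Real.continuous_rpow_const (q := p) (by linarith)
  have hc (y : ℝ) : Continuous (fun u : ℝ => p * y * u ^ (p - 1) - (p - 1) * u ^ p) := by
    fun_prop
  have z1 : (0 : ℝ) ^ (p - 1) = 0 := Real.zero_rpow (by linarith)
  have z2 : (0 : ℝ) ^ p = 0 := Real.zero_rpow (by linarith)
  obtain ⟨κ, ⟨hκ0, hκ1⟩, hκ⟩ := intermediate_value_Icc (zero_le_one (α := ℝ)) (hc 1).continuousOn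
    (show ρ ∈ _ by simp [z1, z2, hρ.le, hρ1.le])
  simp only at hκ
  have hκpos : 0 < κ := by
    refine lt_of_le_of_ne hκ0 ?_
    rintro rfl
    rw [z1, z2] at hκ; linarith
  refine ⟨κ, hκpos, ?_, ?_⟩
  · refine lt_of_le_of_ne hκ1 ?_
    rintro rfl
    simp at hκ; linarith
  · intro y V hy hV hVy
    have hval : p * y * (κ * y) ^ (p - 1) - (p - 1) * (κ * y) ^ p = ρ * y ^ p := by
      rw [← hκ, Real.mul_rpow hκ0 hy.le, Real.mul_rpow hκ0 hy.le, Real.rpow_sub_one hy.ne']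
      field_simp
    obtain ⟨u, ⟨hu0, hu1⟩, hu⟩ := intermediate_value_Icc (mul_pos hκpos hy).le
      (hc y).continuousOn (show V ∈ _ by simp only [hval, z1, z2]; constructor <;> linarith)
    simp only at hu
    refine ⟨u, lt_of_le_of_ne hu0 ?_, hu1, hu⟩
    rintro rfl
    rw [z1, z2] at hu; linarith

/-- The functional dominates the boundary values of the Bellman function. -/
theorem rpow_neg_le_supportFun {p b ε k y V u : ℝ} (hp : 1 < p) (hb : 0 < b) (hε : 0 < ε)
    (hk : 1 ≤ k) (hkε : (k / ε) ^ p = p * k - (p - 1)) (hbk : 0 < 1 + b - b * k)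
    (hu : 0 < u) (huy : u ≤ y) (hV : y ^ p / ε ^ p ≤ V) :
    y ^ (-b) ≤ k ^ (-b) / (1 + b - b * k) * supportFun p b 1 y V u := by
  have hy : 0 < y := hu.trans_le huy
  have hk0 : 0 < k := by linarith
  have hu' : 0 < y / k := by positivity
  have htan : p * y * (y / k) ^ (p - 1) - (p - 1) * (y / k) ^ p = y ^ p / ε ^ p := by
    rw [Real.div_rpow hk0.le hε.le] at hkε
    have := Real.rpow_pos_of_pos hε p
    have := Real.rpow_pos_of_pos hk0 p
    have := Real.rpow_pos_of_pos hy p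
    rw [Real.rpow_sub_one hu'.ne', Real.div_rpow hy.le hk0.le]
    field_simp at hkε ⊢
    linear_combination -hkε
  have hmin := supportFun_le hp hb hu' (div_le_self hy.le hk) hu huy htan
  rw [supportFun_tangent hp hu' htan] at hmin
  have hmon : supportFun p b 1 y (y ^ p / ε ^ p) u ≤ supportFun p b 1 y V u := by
    have : 0 < p - 1 := by linarith
    unfold supportFun
    gcongr
  have hC : 0 ≤ k ^ (-b) / (1 + b - b * k) := by positivity
  refine le_trans (le_of_eq ?_) (mul_le_mul_of_nonneg_left (hmin.trans hmon) hC)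
  have := Real.rpow_pos_of_pos hk0 (-b)
  rw [Real.div_rpow hy.le hk0.le]
  field_simp
  ring

theorem supportFun_mul {p b l x V u : ℝ} :
    supportFun p b l (l * x) (l * V) u = l * supportFun p b 1 x V u := by
  unfold supportFun; ring

theorem supportFun_add {p b l W V l' W' V' u : ℝ} :
    supportFun p b (l + l') (W + W') (V + V') u
      = supportFun p b l W V u + supportFun p b l' W' V' u := by
  unfold supportFun; ring

/-- The step functions obtained by repeatedly splitting `[a, b)` at `c a b`. -/
noncomputable def splitStep (c : ℝ → ℝ → ℝ) (F : ℝ → ℝ → ℝ≥0∞) : ℕ → ℝ → ℝ → ℝ → ℝ≥0∞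
  | 0, a, b, _ => F a b
  | n + 1, a, b, t =>
    if t < c a b then splitStep c F n a (c a b) t else splitStep c F n (c a b) b t

theorem measurable_splitStep (c : ℝ → ℝ → ℝ) (F : ℝ → ℝ → ℝ≥0∞) (n : ℕ) (a b : ℝ) :
    Measurable (splitStep c F n a b) := by
  induction n generalizing a b with
  | zero => exact measurable_const
  | succ n ih => exact Measurable.ite measurableSet_Iio (ih _ _) (ih _ _)

theorem lintegral_splitStep_le {c : ℝ → ℝ → ℝ} {F Φ : ℝ → ℝ → ℝ≥0∞} {G : ℝ → ℝ → Prop}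
    (hc : ∀ a b, G a b → a < c a b ∧ c a b < b ∧ G a (c a b) ∧ G (c a b) b)
    (hF : ∀ a b, G a b → F a b * ENNReal.ofReal (b - a) ≤ Φ a b)
    (hΦ : ∀ a b, G a b → Φ a (c a b) + Φ (c a b) b ≤ Φ a b) (n : ℕ) {a b : ℝ} (h : G a b) :
    ∫⁻ t in Ico a b, splitStep c F n a b t ≤ Φ a b := by
  induction n generalizing a b with
  | zero => simpa [splitStep] using hF a b h
  | succ n ih =>
    obtain ⟨h1, h2, h3, h4⟩ := hc a b h
    rw [← Ico_union_Ico_eq_Ico h1.le h2.le, lintegral_union measurableSet_Ico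
      (by rw [Set.disjoint_left]; intro x hx hx'; exact absurd hx.2 (not_lt.2 hx'.1))]
    refine le_trans (add_le_add (le_trans (le_of_eq ?_) (ih h3))
      (le_trans (le_of_eq ?_) (ih h4))) (hΦ a b h)
    · exact setLIntegral_congr_fun measurableSet_Ico fun t ht => by simp [splitStep, ht.2]
    · exact setLIntegral_congr_fun measurableSet_Ico fun t ht => by simp [splitStep, ht.1]

theorem exists_splitStep_eq {c : ℝ → ℝ → ℝ} {F : ℝ → ℝ → ℝ≥0∞} {G : ℝ → ℝ → Prop} {θ : ℝ}
    (hθ : 0 ≤ θ)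
    (hc : ∀ a b, G a b → a < c a b ∧ c a b < b ∧ G a (c a b) ∧ G (c a b) b)
    (hcθ : ∀ a b, G a b → c a b - a ≤ θ * (b - a) ∧ b - c a b ≤ θ * (b - a))
    (n : ℕ) {a b : ℝ} (h : G a b) {t : ℝ} (ht : t ∈ Ico a b) :
    ∃ α β, a ≤ α ∧ α ≤ t ∧ t < β ∧ β ≤ b ∧ β - α ≤ θ ^ n * (b - a) ∧
      splitStep c F n a b t = F α β := by
  induction n generalizing a b with
  | zero => exact ⟨a, b, le_rfl, ht.1, ht.2, le_rfl, by simp, rfl⟩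
  | succ n ih =>
    obtain ⟨h1, h2, h3, h4⟩ := hc a b h
    obtain ⟨k1, k2⟩ := hcθ a b h
    by_cases htc : t < c a b
    · obtain ⟨α, β, i1, i2, i3, i4, i5, i6⟩ := ih h3 ⟨ht.1, htc⟩
      refine ⟨α, β, i1, i2, i3, i4.trans h2.le, i5.trans ?_, by simp [splitStep, htc, i6]⟩
      rw [pow_succ, mul_assoc]
      gcongr
    · obtain ⟨α, β, i1, i2, i3, i4, i5, i6⟩ := ih h4 ⟨not_lt.1 htc, ht.2⟩
      refine ⟨α, β, h1.le.trans i1, i2, i3, i4, i5.trans ?_, by simp [splitStep, htc, i6]⟩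
      rw [pow_succ, mul_assoc]
      gcongr

theorem lintegral_le_of_splitting {c : ℝ → ℝ → ℝ} {F Φ : ℝ → ℝ → ℝ≥0∞} {G : ℝ → ℝ → Prop} {θ : ℝ}
    (hθ : 0 ≤ θ) (hθ1 : θ < 1)
    (hc : ∀ a b, G a b → a < c a b ∧ c a b < b ∧ G a (c a b) ∧ G (c a b) b)
    (hcθ : ∀ a b, G a b → c a b - a ≤ θ * (b - a) ∧ b - c a b ≤ θ * (b - a))
    (hF : ∀ a b, G a b → F a b * ENNReal.ofReal (b - a) ≤ Φ a b)
    (hΦ : ∀ a b, G a b → Φ a (c a b) + Φ (c a b) b ≤ Φ a b)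
    {A B : ℝ} (hAB : G A B) {g : ℝ → ℝ≥0∞}
    (hg : ∀ᵐ t, t ∈ Ioo A B → ∀ α β : ℕ → ℝ, (∀ n, A ≤ α n ∧ α n ≤ t ∧ t < β n ∧ β n ≤ B) →
      Tendsto (fun n => β n - α n) atTop (𝓝 0) → Tendsto (fun n => F (α n) (β n)) atTop (𝓝 (g t))) :
    ∫⁻ t in Ioo A B, g t ≤ Φ A B := by
  have hlim : ∀ᵐ t, t ∈ Ioo A B → g t = liminf (fun n => splitStep c F n A B t) atTop := by
    filter_upwards [hg] with t ht htm
    choose α β h1 h2 h3 h4 h5 h6 using fun n =>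
      exists_splitStep_eq (F := F) hθ hc hcθ n hAB ⟨htm.1.le, htm.2⟩
    have := ht htm α β (fun n => ⟨h1 n, h2 n, h3 n, h4 n⟩) <| by
      refine squeeze_zero (fun n => by linarith [h2 n, h3 n]) h5 ?_
      simpa using (tendsto_pow_atTop_nhds_zero_of_lt_one hθ hθ1).mul_const (B - A)
    simp_rw [h6]
    exact this.liminf_eq.symm
  rw [setLIntegral_congr_fun_ae measurableSet_Ioo hlim]
  refine (lintegral_liminf_le fun n => measurable_splitStep c F n A B).trans ?_
  refine (liminf_le_liminf (v := fun _ => Φ A B) (Eventually.of_forall fun n => ?_)).trans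
    (by simp)
  exact (lintegral_mono_set Ioo_subset_Ico_self).trans (lintegral_splitStep_le hc hF hΦ n hAB)

theorem ae_tendsto_average_interval {w : ℝ → ℝ≥0∞} (hw : Measurable w) {A B : ℝ}
    (hfin : ∫⁻ t in Ioo A B, w t ≠ ⊤) :
    ∀ᵐ t, t ∈ Ioo A B → ∀ α β : ℕ → ℝ, (∀ n, A ≤ α n ∧ α n ≤ t ∧ t < β n ∧ β n ≤ B) →
      Tendsto (fun n => β n - α n) atTop (𝓝 0) →
      Tendsto (fun n => (∫⁻ s in Ioo (α n) (β n), w s) / ENNReal.ofReal (β n - α n)) atTop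
        (𝓝 (w t)) := by
  have hfin' : ∫⁻ t, (Ioo A B).indicator w t ≠ ⊤ := by
    rwa [lintegral_indicator measurableSet_Ioo]
  have := (IsUnifLocDoublingMeasure.vitaliFamily (volume : Measure ℝ) 1).ae_tendsto_lintegral_div
    (hw.indicator measurableSet_Ioo).aemeasurable hfin'
  filter_upwards [this] with t ht htm α β h hlim
  have hball := IsUnifLocDoublingMeasure.tendsto_closedBall_filterAt (volume : Measure ℝ) (K := 1)
    (x := t) (l := atTop) (fun n => (α n + β n) / 2) (fun n => (β n - α n) / 2)
    (tendsto_nhdsWithin_iff.2 ⟨by simpa using hlim.div_const 2,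
      Eventually.of_forall fun n => by
        have := h n
        simp only [mem_Ioi]; linarith⟩)
    (Eventually.of_forall fun n => by
      have := h n
      rw [one_mul, Metric.mem_closedBall, Real.dist_eq, abs_le]; constructor <;> linarith)
  have := ht.comp hball
  rw [indicator_of_mem htm] at this
  refine this.congr fun n => ?_
  obtain ⟨h1, h2, h3, h4⟩ := h n
  have e : Metric.closedBall ((α n + β n) / 2) ((β n - α n) / 2) = Icc (α n) (β n) := by
    rw [Real.closedBall_eq_Icc]; congr 1 <;> ring
  simp only [Function.comp, e, Real.volume_Icc]
  congr 1
  rw [setLIntegral_congr Ioo_ae_eq_Icc.symm]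
  exact setLIntegral_congr_fun measurableSet_Ioo fun s hs =>
    indicator_of_mem (Ioo_subset_Ioo h1 h4 hs) _

theorem rpow_average_le {p a b : ℝ} {f : ℝ → ℝ} (hp : 1 ≤ p) (hab : a < b) (hf : ∀ t, 0 ≤ f t)
    (h1 : IntervalIntegrable f volume a b)
    (h2 : IntervalIntegrable (fun t => f t ^ p) volume a b) :
    ((∫ t in a..b, f t) / (b - a)) ^ p ≤ (∫ t in a..b, f t ^ p) / (b - a) := by
  have hvol : volume.real (Ioc a b) = b - a := by simp [hab.le]
  have := (convexOn_rpow hp).map_set_average_le (μ := volume) (t := Ioc a b) (f := f)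
    (Real.continuous_rpow_const (by linarith)).continuousOn isClosed_Ici (by simp [hab]) (by simp)
    (Eventually.of_forall hf) h1.1 h2.1
  rw [setAverage_eq, setAverage_eq, hvol, smul_eq_mul, smul_eq_mul] at this
  rwa [intervalIntegral.integral_of_le hab.le, intervalIntegral.integral_of_le hab.le,
    div_eq_inv_mul, div_eq_inv_mul]

/-- Subintervals carrying a fixed fraction of the mass of a reverse Hölder weight have a
fixed fraction of the length. -/
theorem length_ge_of_integral_ge {p δ a b c d τ : ℝ} {f : ℝ → ℝ} (hp : 1 < p) (hδ : 1 ≤ δ)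
    (hf : ∀ t, 0 ≤ f t) (hac : a ≤ c) (hcd : c < d) (hdb : d ≤ b) (hτ : 0 ≤ τ)
    (h1 : IntervalIntegrable f volume a b)
    (h2 : IntervalIntegrable (fun t => f t ^ p) volume a b)
    (hrh : (∫ t in a..b, f t ^ p) / (b - a) ≤ δ ^ p * ((∫ t in a..b, f t) / (b - a)) ^ p)
    (hpos : 0 < ∫ t in a..b, f t) (hmass : τ * (∫ t in a..b, f t) ≤ ∫ t in c..d, f t) :
    (τ / δ) ^ (p / (p - 1)) * (b - a) ≤ d - c := by
  have hab : a < b := by linarith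
  have hsub : uIcc c d ⊆ uIcc a b := by
    rw [uIcc_of_le hcd.le, uIcc_of_le hab.le]; exact Icc_subset_Icc hac hdb
  have hJ := rpow_average_le hp.le hcd hf (h1.mono_set hsub) (h2.mono_set hsub)
  have hmono : ∫ t in c..d, f t ^ p ≤ ∫ t in a..b, f t ^ p :=
    intervalIntegral.integral_mono_interval hac hcd.le hdb
      (Eventually.of_forall fun t => Real.rpow_nonneg (hf t) p) h2
  set W := ∫ t in a..b, f t
  set l := b - a
  set m := d - c
  have hl : 0 < l := by simp only [l]; linarith
  have hm : 0 < m := by simp only [m]; linarith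
  have hWp := Real.rpow_pos_of_pos hpos p
  have hlp := Real.rpow_pos_of_pos hl p
  have hmp := Real.rpow_pos_of_pos hm p
  have hδp := Real.rpow_pos_of_pos (show 0 < δ by linarith) p
  have k1 : (τ * W / m) ^ p ≤ (∫ t in c..d, f t ^ p) / m :=
    (Real.rpow_le_rpow (by positivity) (by gcongr) (by linarith)).trans hJ
  have k2 : (τ * W / m) ^ p ≤ l / m * (δ ^ p * (W / l) ^ p) := by
    refine k1.trans ?_
    have : (∫ t in c..d, f t ^ p) / m ≤ l / m * ((∫ t in a..b, f t ^ p) / l) := by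
      rw [show l / m * ((∫ t in a..b, f t ^ p) / l) = (∫ t in a..b, f t ^ p) / m by field_simp]
      gcongr
    exact this.trans (by gcongr)
  have k3 : (τ / δ) ^ p ≤ (m / l) ^ (p - 1) := by
    rw [Real.div_rpow (by positivity) hm.le, Real.mul_rpow hτ hpos.le,
      Real.div_rpow hpos.le hl.le] at k2
    rw [Real.rpow_sub_one (by positivity), Real.div_rpow hτ (by linarith),
      Real.div_rpow hm.le hl.le]
    rw [div_le_iff₀ hmp] at k2
    rw [div_le_iff₀ hδp]
    refine le_of_mul_le_mul_right (k2.trans (le_of_eq ?_)) hWp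
    field_simp
  have k4 := Real.rpow_le_rpow (by positivity) k3 (show 0 ≤ (p - 1)⁻¹ by
    have : 0 < p - 1 := by linarith
    positivity)
  rw [← Real.rpow_mul (by positivity), ← Real.rpow_mul (by positivity),
    mul_inv_cancel₀ (by linarith), Real.rpow_one, ← div_eq_mul_inv] at k4
  rwa [le_div_iff₀ hl] at k4

/-- If short pieces cannot carry the fraction `1 - κ` of the mass, an interval splits into two
comparable pieces on which the averages stay above `u`. -/
theorem exists_split {a b u κ η : ℝ} {f : ℝ → ℝ} (hab : a < b) (hη : 0 < η) (hη2 : η ≤ 1 / 2)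
    (hf : IntervalIntegrable f volume a b) (hu : 0 < u)
    (huκ : u * (b - a) ≤ κ * ∫ t in a..b, f t) (hκ1 : κ < 1)
    (hpos : 0 < ∫ t in a..b, f t)
    (hlen : ∀ c d, a ≤ c → c < d → d ≤ b →
      (1 - κ) * (∫ t in a..b, f t) ≤ ∫ t in c..d, f t → η * (b - a) ≤ d - c) :
    ∃ c, a < c ∧ c < b ∧ u * (c - a) ≤ ∫ t in a..c, f t ∧ u * (b - c) ≤ ∫ t in c..b, f t ∧
      c - a ≤ (1 - η) * (b - a) ∧ b - c ≤ (1 - η) * (b - a) := by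
  have hi {x y : ℝ} (hx : x ∈ Icc a b) (hy : y ∈ Icc a b) : IntervalIntegrable f volume x y :=
    hf.mono_set (by rw [uIcc_of_le hab.le]; exact uIcc_subset_Icc hx hy)
  have hadd {x : ℝ} (hx : x ∈ Icc a b) :
      (∫ t in a..x, f t) + ∫ t in x..b, f t = ∫ t in a..b, f t :=
    intervalIntegral.integral_add_adjacent_intervals (hi ⟨le_rfl, hab.le⟩ hx)
      (hi hx ⟨hab.le, le_rfl⟩)
  have hcont : ContinuousOn (fun x => ∫ t in a..x, f t) (Icc a b) := by
    have := intervalIntegral.continuousOn_primitive_interval (μ := volume) (f := f) (a := a)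
      (b := b) (by rw [uIcc_of_le hab.le]; exact (integrableOn_Icc_iff_integrableOn_Ioc (by simp)).2 hf.1)
    rwa [uIcc_of_le hab.le] at this
  set W := ∫ t in a..b, f t
  have hl : 0 < b - a := by linarith
  have hul : 0 < u * (b - a) := by positivity
  have hηl : 0 < η * (b - a) := by positivity
  have hηl2 : η * (b - a) ≤ 1 / 2 * (b - a) := by gcongr
  set m := (a + b) / 2 with hm
  have hmI : m ∈ Icc a b := by constructor <;> linarith
  have hW : u * (b - a) < W := huκ.trans_lt (mul_lt_of_lt_one_left hpos hκ1)
  by_cases hL : u * (m - a) ≤ ∫ t in a..m, f t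
  · by_cases hR : u * (b - m) ≤ ∫ t in m..b, f t
    · exact ⟨m, by linarith, by linarith, hL, hR, by linarith, by linarith⟩
    · push Not at hR
      have hc' : ContinuousOn (fun x => (W - ∫ t in a..x, f t) - u * (b - x)) (Icc a m) :=
        ((continuousOn_const.sub hcont).sub (by fun_prop)).mono (Icc_subset_Icc le_rfl hmI.2)
      obtain ⟨c, ⟨hc1, hc2⟩, hc⟩ := intermediate_value_Icc' hmI.1 hc' (show (0 : ℝ) ∈ _ by
        have := hadd hmI
        simp only [intervalIntegral.integral_same, sub_zero]
        constructor <;> linarith)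
      have hcI : c ∈ Icc a b := ⟨hc1, hc2.trans hmI.2⟩
      have hac := hadd hcI
      simp only at hc
      have hlc : u * (b - c) ≤ u * (b - a) := by gcongr
      have hca : a < c := by
        refine lt_of_le_of_ne hc1 ?_
        rintro rfl
        simp at hc; linarith
      have := hlen a c le_rfl hca hcI.2 (by linarith)
      exact ⟨c, hca, by linarith, by linarith, by linarith, by linarith, by linarith⟩
  · push Not at hL
    have hc' : ContinuousOn (fun x => (∫ t in a..x, f t) - u * (x - a)) (Icc m b) :=
      (hcont.sub (by fun_prop)).mono (Icc_subset_Icc hmI.1 le_rfl)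
    obtain ⟨c, ⟨hc1, hc2⟩, hc⟩ := intermediate_value_Icc hmI.2 hc' (show (0 : ℝ) ∈ _ by
      constructor <;> linarith)
    have hcI : c ∈ Icc a b := ⟨hmI.1.trans hc1, hc2⟩
    have hac := hadd hcI
    simp only at hc
    have hlc : u * (c - a) ≤ u * (b - a) := by gcongr
    have hcb : c < b := by
      refine lt_of_le_of_ne hc2 ?_
      rintro rfl
      linarith
    have := hlen c b hcI.1 hcb le_rfl (by linarith)
    exact ⟨c, by linarith, hcb, by linarith, by linarith, by linarith, by linarith⟩

theorem lintegral_Ioo_ofReal {a b : ℝ} {f : ℝ → ℝ} (hab : a ≤ b) (hf : ∀ t, 0 ≤ f t)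
    (h : IntervalIntegrable f volume a b) :
    ∫⁻ t in Ioo a b, ENNReal.ofReal (f t) = ENNReal.ofReal (∫ t in a..b, f t) := by
  rw [intervalIntegral.integral_of_le hab, ← setLIntegral_congr Ioo_ae_eq_Ioc.symm,
    ofReal_integral_eq_lintegral_ofReal h.1 (Eventually.of_forall hf)]

theorem lintegral_rpow_neg_le {p δ ε b k A B u : ℝ} {f : ℝ → ℝ} (hp : 1 < p) (hδ : 1 ≤ δ)
    (hε : δ < ε) (hb : 0 < b) (hk : 1 ≤ k) (hkε : (k / ε) ^ p = p * k - (p - 1))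
    (hbk : 0 < 1 + b - b * k) (hAB : A < B) (hf : ∀ t, 0 ≤ f t) (hfm : Measurable f)
    (h1 : IntervalIntegrable f volume A B)
    (h2 : IntervalIntegrable (fun t => f t ^ p) volume A B)
    (hrh : ∀ x y, A ≤ x → x < y → y ≤ B →
      (∫ t in x..y, f t ^ p) / (y - x) ≤ δ ^ p * ((∫ t in x..y, f t) / (y - x)) ^ p)
    (hpos : 0 < ∫ t in A..B, f t) (hu : 0 < u) (hu' : u ≤ (∫ t in A..B, f t) / (B - A)) :
    ∫⁻ t in Ioo A B, ENNReal.ofReal (f t) ^ (-b) ≤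
      ENNReal.ofReal (k ^ (-b) / (1 + b - b * k) *
        supportFun p b (B - A) (∫ t in A..B, f t) ((∫ t in A..B, f t ^ p) / ε ^ p) u) := by
  have hε0 : 0 < ε := by linarith
  have hδ0 : 0 < δ := by linarith
  have hεp := Real.rpow_pos_of_pos hε0 p
  have hδp := Real.rpow_pos_of_pos hδ0 p
  have hC : 0 < k ^ (-b) / (1 + b - b * k) := by positivity
  have hi {g : ℝ → ℝ} (hg : IntervalIntegrable g volume A B) {x y : ℝ} (hx : x ∈ Icc A B)
      (hy : y ∈ Icc A B) : IntervalIntegrable g volume x y :=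
    hg.mono_set (by rw [uIcc_of_le hAB.le]; exact uIcc_subset_Icc hx hy)
  set C := k ^ (-b) / (1 + b - b * k)
  set W : ℝ → ℝ → ℝ := fun x y => ∫ t in x..y, f t with hWdef
  set V : ℝ → ℝ → ℝ := fun x y => (∫ t in x..y, f t ^ p) / ε ^ p with hVdef
  let G : ℝ → ℝ → Prop := fun x y => A ≤ x ∧ x < y ∧ y ≤ B ∧ 0 < W x y
  have hVlow {x y : ℝ} (h : G x y) : (W x y / (y - x)) ^ p / ε ^ p ≤ V x y / (y - x) := by
    obtain ⟨hx, hxy, hy, -⟩ := h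
    have := rpow_average_le hp.le hxy hf (hi h1 ⟨hx, by linarith⟩ ⟨by linarith, hy⟩)
      (hi h2 ⟨hx, by linarith⟩ ⟨by linarith, hy⟩)
    rw [hVdef, div_right_comm]
    gcongr
  have hscale {x y : ℝ} (h : G x y) (v : ℝ) : supportFun p b (y - x) (W x y) (V x y) v
      = (y - x) * supportFun p b 1 (W x y / (y - x)) (V x y / (y - x)) v := by
    have : y - x ≠ 0 := by linarith [h.2.1]
    rw [← supportFun_mul, mul_div_cancel₀ _ this, mul_div_cancel₀ _ this]
  have hbase {x y v : ℝ} (h : G x y) (hv : 0 < v) (hv' : v ≤ W x y / (y - x)) :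
      (W x y / (y - x)) ^ (-b) * (y - x) ≤ C * supportFun p b (y - x) (W x y) (V x y) v := by
    have := rpow_neg_le_supportFun hp hb hε0 hk hkε hbk hv hv' (hVlow h)
    have hl : 0 < y - x := by linarith [h.2.1]
    rw [hscale h, mul_left_comm, mul_comm]
    gcongr
  have hρ1 : (δ / ε) ^ p < 1 :=
    Real.rpow_lt_one (by positivity) ((div_lt_one hε0).2 hε) (by linarith)
  obtain ⟨κ, hκ0, hκ1, hκ⟩ := exists_tangent hp (Real.rpow_pos_of_pos (div_pos hδ0 hε0) p) hρ1
  set η : ℝ := min (((1 - κ) / δ) ^ (p / (p - 1))) (1 / 2)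
  have hη0 : 0 < η := lt_min (Real.rpow_pos_of_pos (div_pos (by linarith) hδ0) _) (by norm_num)
  have hη2 : η ≤ 1 / 2 := min_le_right _ _
  have hsplit (x y : ℝ) : ∃ c, G x y → x < c ∧ c < y ∧ G x c ∧ G c y ∧
      (c - x ≤ (1 - η) * (y - x) ∧ y - c ≤ (1 - η) * (y - x)) ∧
      ∀ v, 0 < v → v ≤ W x y / (y - x) → ∃ v', 0 < v' ∧ v' ≤ W x c / (c - x) ∧
        v' ≤ W c y / (y - c) ∧ supportFun p b (y - x) (W x y) (V x y) v' ≤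
          supportFun p b (y - x) (W x y) (V x y) v := by
    by_cases hG : G x y
    swap
    · exact ⟨x, fun h => absurd h hG⟩
    obtain ⟨hx, hxy, hy, hWpos⟩ := id hG
    have hxI : x ∈ Icc A B := ⟨hx, by linarith⟩
    have hyI : y ∈ Icc A B := ⟨by linarith, hy⟩
    have hl : 0 < y - x := by linarith
    have havg : 0 < W x y / (y - x) := by positivity
    obtain ⟨v', hv'0, hv'1, hv'2⟩ := hκ (W x y / (y - x)) (V x y / (y - x)) havg
      (lt_of_lt_of_le (by positivity) (hVlow hG)) (by
        rw [hVdef, div_right_comm, Real.div_rpow hδ0.le hε0.le, div_mul_eq_mul_div]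
        gcongr
        exact hrh x y hx hxy hy)
    have hv'3 : v' ≤ W x y / (y - x) := hv'1.trans (mul_le_of_le_one_left havg.le hκ1.le)
    obtain ⟨c, hc1, hc2, hc3, hc4, hc5, hc6⟩ := exists_split hxy hη0 hη2 (hi h1 hxI hyI) hv'0
      (κ := κ) (by rwa [← mul_div_assoc, le_div_iff₀ hl] at hv'1) hκ1 hWpos
      (fun c d hc hcd hd hm => (mul_le_mul_of_nonneg_right (min_le_left _ _) hl.le).trans
        (length_ge_of_integral_ge hp hδ hf hc hcd hd (by linarith) (hi h1 hxI hyI)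
          (hi h2 hxI hyI) (hrh x y hx hxy hy) hWpos hm))
    have hcx : 0 < c - x := by linarith
    have hyc : 0 < y - c := by linarith
    refine ⟨c, fun _ => ⟨hc1, hc2, ⟨hx, hc1, by linarith, lt_of_lt_of_le (by positivity) hc3⟩,
      ⟨by linarith, hc2, hy, lt_of_lt_of_le (by positivity) hc4⟩, ⟨hc5, hc6⟩, fun v hv hvy =>
      ⟨v', hv'0, by rwa [le_div_iff₀ hcx], by rwa [le_div_iff₀ hyc], ?_⟩⟩⟩
    rw [hscale hG, hscale hG]
    exact mul_le_mul_of_nonneg_left (supportFun_le hp hb hv'0 hv'3 hv hvy hv'2) hl.le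
  choose c hc using hsplit
  refine (lintegral_le_of_splitting (c := c) (G := G) (θ := 1 - η)
    (F := fun x y => ENNReal.ofReal (W x y / (y - x)) ^ (-b))
    (Φ := fun x y => ⨅ v : ℝ, ⨅ _ : 0 < v ∧ v ≤ W x y / (y - x),
      ENNReal.ofReal (C * supportFun p b (y - x) (W x y) (V x y) v))
    (by linarith) (by linarith)
    (fun x y h => ⟨(hc x y h).1, (hc x y h).2.1, (hc x y h).2.2.1, (hc x y h).2.2.2.1⟩)
    (fun x y h => (hc x y h).2.2.2.2.1) ?_ ?_ (A := A) (B := B) ⟨le_rfl, hAB, le_rfl, hpos⟩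
    ?_).trans (iInf₂_le u ⟨hu, hu'⟩)
  · intro x y h
    refine le_iInf₂ fun v hv => ?_
    have hl : 0 < y - x := by linarith [h.2.1]
    have hm : 0 < W x y / (y - x) := div_pos h.2.2.2 hl
    rw [ENNReal.ofReal_rpow_of_pos hm, ← ENNReal.ofReal_mul (by positivity)]
    exact ENNReal.ofReal_le_ofReal (hbase h hv.1 hv.2)
  · intro x y h
    refine le_iInf₂ fun v hv => ?_
    obtain ⟨hc1, hc2, hG1, hG2, -, hval⟩ := hc x y h
    obtain ⟨v', hv'0, hv'1, hv'2, hle⟩ := hval v hv.1 hv.2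
    refine (add_le_add (iInf₂_le v' ⟨hv'0, hv'1⟩) (iInf₂_le v' ⟨hv'0, hv'2⟩)).trans ?_
    have hnn {x y : ℝ} (h : G x y) (hv : v' ≤ W x y / (y - x)) :
        0 ≤ C * supportFun p b (y - x) (W x y) (V x y) v' := by
      refine le_trans ?_ (hbase h hv'0 hv)
      have hl : 0 < y - x := by linarith [h.2.1]
      have hm : 0 < W x y / (y - x) := div_pos h.2.2.2 hl
      positivity
    rw [← ENNReal.ofReal_add (hnn hG1 hv'1) (hnn hG2 hv'2), ← mul_add, ← supportFun_add]
    refine ENNReal.ofReal_le_ofReal (mul_le_mul_of_nonneg_left (le_trans (le_of_eq ?_) hle) hC.le)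
    have hxI : x ∈ Icc A B := ⟨h.1, by linarith [h.2.1, h.2.2.1]⟩
    have hyI : y ∈ Icc A B := ⟨by linarith [h.2.1, h.1], h.2.2.1⟩
    have hcI : c x y ∈ Icc A B := ⟨by linarith [h.1], by linarith [h.2.2.1]⟩
    have e1 : W x (c x y) + W (c x y) y = W x y :=
      intervalIntegral.integral_add_adjacent_intervals (hi h1 hxI hcI) (hi h1 hcI hyI)
    have e2 : V x (c x y) + V (c x y) y = V x y := by
      simp only [hVdef]
      rw [← add_div, intervalIntegral.integral_add_adjacent_intervals (hi h2 hxI hcI)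
        (hi h2 hcI hyI)]
    rw [e1, e2]
    congr 1
    ring
  · have hfin : ∫⁻ t in Ioo A B, ENNReal.ofReal (f t) ≠ ⊤ := by
      rw [lintegral_Ioo_ofReal hAB.le hf h1]; exact ENNReal.ofReal_ne_top
    filter_upwards [ae_tendsto_average_interval hfm.ennreal_ofReal hfin] with t ht htm α β h hlim
    refine ((ENNReal.continuous_rpow_const (y := -b)).continuousAt.tendsto.comp
      (ht htm α β h hlim)).congr fun n => ?_
    obtain ⟨i1, i2, i3, i4⟩ := h n
    have hl : 0 < β n - α n := by linarith
    simp only [Function.comp]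
    rw [lintegral_Ioo_ofReal (by linarith) hf (hi h1 ⟨i1, by linarith⟩ ⟨by linarith, i4⟩),
      ENNReal.ofReal_div_of_pos hl]

theorem intervalIntegrable_toReal {g : ℝ → ℝ≥0∞} {A B : ℝ} (hAB : A ≤ B) (hg : Measurable g)
    (hfin : ∫⁻ t in Ioo A B, g t ≠ ⊤) :
    IntervalIntegrable (fun t => (g t).toReal) volume A B :=
  (intervalIntegrable_iff_integrableOn_Ioo_of_le hAB).2
    (integrable_toReal_of_lintegral_ne_top hg.aemeasurable hfin)

theorem avgE_eq_ofReal {g : ℝ → ℝ≥0∞} {A B a b : ℝ} (hg : Measurable g)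
    (hfin : ∫⁻ t in Ioo A B, g t ≠ ⊤) (ha : A ≤ a) (hab : a < b) (hb : b ≤ B) :
    avgE g a b = ENNReal.ofReal ((∫ t in a..b, (g t).toReal) / (b - a)) := by
  have hfin' : ∫⁻ t in Ioo a b, g t ≠ ⊤ :=
    ne_top_of_le_ne_top hfin (lintegral_mono_set (Ioo_subset_Ioo ha hb))
  rw [avgE, ENNReal.ofReal_div_of_pos (sub_pos.2 hab), intervalIntegral.integral_of_le hab.le,
    setIntegral_congr_set Ioo_ae_eq_Ioc.symm, integral_toReal hg.aemeasurable
      (ae_lt_top hg hfin'), ENNReal.ofReal_toReal hfin']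

theorem lintegral_ne_top_of_avgE_ne_top {g : ℝ → ℝ≥0∞} {a b : ℝ} (h : avgE g a b ≠ ⊤) :
    ∫⁻ t in Ioo a b, g t ≠ ⊤ := by
  intro h'
  rw [avgE, h', ENNReal.top_div_of_ne_top ENNReal.ofReal_ne_top] at h
  exact h rfl

/-- The substitution `k = (1 - (p - 1) s) / (1 - p s)` between the two parametrizations. -/
theorem div_rpow_eq_of_param {p s ρ : ℝ} (hD : 0 < 1 - p * s) (hE : 0 < 1 - (p - 1) * s)
    (h : (1 - p * s) ^ (p - 1) / (1 - (p - 1) * s) ^ p = ρ) :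
    ((1 - (p - 1) * s) / (1 - p * s)) ^ p * ρ
      = p * ((1 - (p - 1) * s) / (1 - p * s)) - (p - 1) := by
  rw [← h, Real.div_rpow hE.le hD.le, Real.rpow_sub_one hD.ne']
  have := Real.rpow_pos_of_pos hD p
  have := Real.rpow_pos_of_pos hE p
  field_simp
  ring

theorem param_pos {p s ρ : ℝ} (hp : 1 < p) (hs : s ≤ 1 / p) (hρ : 0 < ρ)
    (h : (1 - p * s) ^ (p - 1) / (1 - (p - 1) * s) ^ p = ρ) :
    0 < 1 - p * s ∧ 0 < 1 - (p - 1) * s := by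
  have hps : p * s ≤ 1 := by rwa [le_div_iff₀ (by linarith), mul_comm] at hs
  have hD : 0 < 1 - p * s := by
    refine lt_of_le_of_ne (by linarith) fun h0 => ?_
    rw [← h0, Real.zero_rpow (by linarith), zero_div] at h
    linarith
  refine ⟨hD, ?_⟩
  by_contra! h'
  nlinarith

theorem le_of_tangency_eq {p ε k x : ℝ} (hp : 1 < p) (hε : 1 < ε) (hk : 0 ≤ k) (hx : 1 < x)
    (hkε : (k / ε) ^ p = p * k - (p - 1)) (hxε : (x / ε) ^ p = p * x - (p - 1)) : k ≤ x := by
  by_contra! hlt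
  have hε0 : 0 < ε := by linarith
  have h1 : (1 / ε) ^ p < 1 :=
    Real.rpow_lt_one (by positivity) ((div_lt_one hε0).2 hε) (by linarith)
  have hconv := (convexOn_rpow hp.le).2
  have hc := hconv (show 1 / ε ∈ Ici 0 from by simp [hε0.le])
    (show k / ε ∈ Ici 0 from div_nonneg hk hε0.le)
    (div_nonneg (by linarith) (by linarith) : 0 ≤ (k - x) / (k - 1))
    (div_nonneg (by linarith) (by linarith) : 0 ≤ (x - 1) / (k - 1))
    (by rw [← add_div]; exact (div_eq_one_iff_eq (by linarith)).2 (by ring))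
  have hk1 : 0 < k - 1 := by linarith
  have e : ((k - x) / (k - 1)) • (1 / ε) + ((x - 1) / (k - 1)) • (k / ε) = x / ε := by
    simp only [smul_eq_mul]; field_simp; ring
  rw [e] at hc
  simp only [smul_eq_mul, hxε, hkε] at hc
  have hlt' : (k - x) / (k - 1) * (1 / ε) ^ p < (k - x) / (k - 1) * 1 :=
    mul_lt_mul_of_pos_left h1 (div_pos (by linarith) hk1)
  have e2 : (k - x) / (k - 1) * 1 + (x - 1) / (k - 1) * (p * k - (p - 1)) = p * x - (p - 1) := by
    field_simp; ring
  linarith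

theorem bellman_value_eq {p b s r x : ℝ} (hx : 0 < x) (hDs : 0 < 1 - p * s)
    (hEs : 0 < 1 - (p - 1) * s) (hDr : 0 < 1 - p * r) (hEr : 0 < 1 - (p - 1) * r) :
    ((1 - (p - 1) * s) / (1 - p * s)) ^ (-b) /
          (1 + b - b * ((1 - (p - 1) * s) / (1 - p * s))) *
        ((x / ((1 - (p - 1) * r) / (1 - p * r))) ^ (-b) *
          ((b + 1) - b * ((1 - (p - 1) * r) / (1 - p * r)))) =
      x ^ (-b) * ((1 - p * s) / (1 - p * r)) ^ (b + 1) *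
        ((1 - (p - 1) * r) / (1 - (p - 1) * s)) ^ b *
        ((1 - (p + b) * r) / (1 - (p + b) * s)) := by
  have es : 1 + b - b * ((1 - (p - 1) * s) / (1 - p * s))
      = (1 - (p + b) * s) / (1 - p * s) := by field_simp; ring
  have er : (b + 1) - b * ((1 - (p - 1) * r) / (1 - p * r))
      = (1 - (p + b) * r) / (1 - p * r) := by field_simp; ring
  rw [es, er, Real.rpow_add_one (div_pos hDs hDr).ne', Real.div_rpow hx.le (by positivity)]
  simp only [Real.rpow_neg (div_pos hEs hDs).le, Real.rpow_neg (div_pos hEr hDr).le]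
  rw [Real.div_rpow hEs.le hDs.le, Real.div_rpow hEr.le hDr.le, Real.div_rpow hEr.le hEs.le,
    Real.div_rpow hDs.le hDr.le]
  have := Real.rpow_pos_of_pos hDs b
  have := Real.rpow_pos_of_pos hDr b
  have := Real.rpow_pos_of_pos hEs b
  have := Real.rpow_pos_of_pos hEr b
  field_simp

theorem statement16 (p δ ε qs q s x₁ x₂ r : ℝ) (hp : 1 < p) (hδ : 1 ≤ δ) (hε : δ < ε)
    (hqs1 : 1 < qs) (hqs : ((qs / ε) ^ p - 1) / (qs - 1) = p) (hq : qs < q)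
    (hs1 : 0 ≤ s) (hs2 : s ≤ 1 / p)
    (hs : (1 - p * s) ^ (p - 1) / (1 - (p - 1) * s) ^ p = ε ^ (-p))
    (A B : ℝ) (hAB : A < B) (w : ℝ → ℝ≥0∞) (hw : MemRH p δ A B w)
    (hx1 : avgE w A B = ENNReal.ofReal x₁) (hx1pos : 0 < x₁)
    (hx2 : avgE (fun t => w t ^ p) A B = ENNReal.ofReal x₂)
    (hr1 : 0 ≤ r) (hr2 : r ≤ 1 / p)
    (hr : (1 - p * r) ^ (p - 1) / (1 - (p - 1) * r) ^ p = x₂ / (ε * x₁) ^ p) :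
    avgE (fun t => w t ^ (1 - q / (q - 1))) A B
      ≤ ENNReal.ofReal (x₁ ^ (1 - q / (q - 1)) *
          ((1 - p * s) / (1 - p * r)) ^ (q / (q - 1)) *
          ((1 - (p - 1) * r) / (1 - (p - 1) * s)) ^ (q / (q - 1) - 1) *
          ((1 - (p + q / (q - 1) - 1) * r) / (1 - (p + q / (q - 1) - 1) * s))) := by
  obtain ⟨hwm, hwfin, hwrh⟩ := hw
  have hq1 : 0 < q - 1 := by linarith
  obtain ⟨b, hb⟩ : ∃ b, b = 1 / (q - 1) := ⟨_, rfl⟩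
  have hb0 : 0 < b := by rw [hb]; positivity
  have hqb : q / (q - 1) = b + 1 := by rw [hb]; field_simp; ring
  rw [show p + q / (q - 1) - 1 = p + b by rw [hqb]; ring, hqb,
    show 1 - (b + 1) = -b by ring, show b + 1 - 1 = b by ring]
  have hε0 : 0 < ε := by linarith
  have hεp := Real.rpow_pos_of_pos hε0 p
  have hl : 0 < B - A := by linarith
  have hwpm : Measurable fun t => w t ^ p := hwm.pow_const p
  have hwpfin : ∫⁻ t in Ioo A B, w t ^ p ≠ ⊤ :=
    lintegral_ne_top_of_avgE_ne_top (by rw [hx2]; exact ENNReal.ofReal_ne_top)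
  have hf (t : ℝ) : 0 ≤ (w t).toReal := ENNReal.toReal_nonneg
  have h1 := intervalIntegrable_toReal hAB.le hwm hwfin
  have h2 := intervalIntegrable_toReal hAB.le hwpm hwpfin
  have a1 {x y : ℝ} (hx : A ≤ x) (hxy : x < y) (hy : y ≤ B) := avgE_eq_ofReal hwm hwfin hx hxy hy
  have a2 {x y : ℝ} (hx : A ≤ x) (hxy : x < y) (hy : y ≤ B) :=
    avgE_eq_ofReal hwpm hwpfin hx hxy hy
  simp only [← ENNReal.toReal_rpow] at h2 a2
  have hW : (∫ t in A..B, (w t).toReal) / (B - A) = x₁ := by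
    rw [a1 le_rfl hAB le_rfl] at hx1
    exact (ENNReal.ofReal_eq_ofReal_iff (div_nonneg (intervalIntegral.integral_nonneg hAB.le
      fun t _ => hf t) hl.le) hx1pos.le).1 hx1
  have hWpos : 0 < ∫ t in A..B, (w t).toReal := by
    rw [div_eq_iff hl.ne'] at hW
    rw [hW]; positivity
  have hJ := rpow_average_le hp.le hAB hf h1 h2
  have hVpos : 0 < (∫ t in A..B, (w t).toReal ^ p) / (B - A) :=
    lt_of_lt_of_le (Real.rpow_pos_of_pos (div_pos hWpos hl) p) hJ
  have hx2pos : 0 < x₂ := by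
    rw [a2 le_rfl hAB le_rfl] at hx2
    exact ENNReal.ofReal_pos.1 (hx2 ▸ ENNReal.ofReal_pos.2 hVpos)
  have hV : (∫ t in A..B, (w t).toReal ^ p) / (B - A) = x₂ := by
    rw [a2 le_rfl hAB le_rfl] at hx2
    exact (ENNReal.ofReal_eq_ofReal_iff hVpos.le hx2pos.le).1 hx2
  have hrh (x y : ℝ) (hx : A ≤ x) (hxy : x < y) (hy : y ≤ B) :
      (∫ t in x..y, (w t).toReal ^ p) / (y - x)
        ≤ δ ^ p * ((∫ t in x..y, (w t).toReal) / (y - x)) ^ p := by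
    have h := hwrh x y hx hxy hy
    have hnn : 0 ≤ (∫ t in x..y, (w t).toReal) / (y - x) :=
      div_nonneg (intervalIntegral.integral_nonneg hxy.le fun t _ => hf t) (by linarith)
    have hδp : 0 ≤ δ ^ p := Real.rpow_nonneg (by linarith) p
    rw [a1 hx hxy hy, a2 hx hxy hy, ENNReal.ofReal_rpow_of_nonneg (by linarith) (by linarith),
      ENNReal.ofReal_rpow_of_nonneg hnn (by linarith), ← ENNReal.ofReal_mul hδp] at h
    exact (ENNReal.ofReal_le_ofReal_iff (mul_nonneg hδp (Real.rpow_nonneg hnn p))).1 h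
  obtain ⟨hDs, hEs⟩ := param_pos hp hs2 (Real.rpow_pos_of_pos hε0 _) hs
  obtain ⟨hDr, hEr⟩ := param_pos hp hr2 (by positivity) hr
  have hks := div_rpow_eq_of_param hDs hEs hs
  have hkr := div_rpow_eq_of_param hDr hEr hr
  have hvalue := bellman_value_eq (b := b) hx1pos hDs hEs hDr hEr
  have hk1 : 1 ≤ (1 - (p - 1) * s) / (1 - p * s) := by rw [le_div_iff₀ hDs]; linarith
  have hk1' : 1 ≤ (1 - (p - 1) * r) / (1 - p * r) := by rw [le_div_iff₀ hDr]; linarith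
  set k := (1 - (p - 1) * s) / (1 - p * s)
  set m := (1 - (p - 1) * r) / (1 - p * r)
  have hm0 : 0 < m := by linarith
  have hkε : (k / ε) ^ p = p * k - (p - 1) := by
    rwa [Real.div_rpow (by linarith) hε0.le, div_eq_mul_inv, ← Real.rpow_neg hε0.le]
  have hkq : k < q := by
    refine (le_of_tangency_eq hp (by linarith) (by linarith) hqs1 hkε ?_).trans_lt hq
    rw [div_eq_iff (by linarith)] at hqs
    linarith
  have hbk : 0 < 1 + b - b * k := by
    have : b * (q - k) = 1 + b - b * k := by rw [hb]; field_simp; ring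
    rw [← this]
    exact mul_pos hb0 (by linarith)
  rw [← hvalue]
  have hu : 0 < x₁ / m := by positivity
  have hux : x₁ / m ≤ x₁ := div_le_self hx1pos.le hk1'
  have htan : p * x₁ * (x₁ / m) ^ (p - 1) - (p - 1) * (x₁ / m) ^ p = x₂ / ε ^ p := by
    have hmp := Real.rpow_pos_of_pos hm0 p
    have hxp := Real.rpow_pos_of_pos hx1pos p
    rw [Real.mul_rpow hε0.le hx1pos.le] at hkr
    rw [Real.rpow_sub_one hu.ne', Real.div_rpow hx1pos.le hm0.le]
    field_simp at hkr ⊢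
    linear_combination -hkr
  have main := lintegral_rpow_neg_le hp hδ hε hb0 hk1 hkε hbk hAB hf hwm.ennreal_toReal h1 h2 hrh
    hWpos hu (by rwa [hW])
  rw [div_eq_iff hl.ne', mul_comm] at hW hV
  rw [hW, hV, mul_div_assoc, supportFun_mul, supportFun_tangent hp hu htan,
    div_div_cancel₀ hx1pos.ne'] at main
  have hae : ∫⁻ t in Ioo A B, w t ^ (-b) = ∫⁻ t in Ioo A B, ENNReal.ofReal (w t).toReal ^ (-b) := by
    refine lintegral_congr_ae ?_
    filter_upwards [ae_lt_top hwm hwfin] with t ht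
    rw [ENNReal.ofReal_toReal ht.ne]
  rw [avgE, hae]
  refine (ENNReal.div_le_div_right main _).trans_eq ?_
  rw [← ENNReal.ofReal_div_of_pos hl]
  congr 1
  field_simp
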